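/- arXiv:1505.01439 — 12 statements merged into one kernel-verified Lean document; each statement's English description precedes it below -/
import Mathlib

section
/- Let p ∈ (0,1), T = (1/p)·ln(1/(1-p)), let F be a finite index set, and for each f ∈ F let p_f ∈ (0,1]. Set S = Σ_{f∈F} p_f and F_f(y) = min(1, (1 − e^{-p_f·y})/p_f). Then ∫₀^T ( Π_{f∈F} (1 − p_f·F_f(y)) )·e^{-p·y} dy ≥ (1/(S+p))·(1 − (1−p)^{(S+p)/p}). -/
theorem exp_neg_mul_le_one_sub_mul_min {q : ℝ} (hq : 0 < q) (y : ℝ) :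
    Real.exp (-q * y) ≤ 1 - q * min 1 ((1 - Real.exp (-q * y)) / q) := by
  have h : q * min 1 ((1 - Real.exp (-q * y)) / q) ≤ 1 - Real.exp (-q * y) :=
    (mul_le_mul_of_nonneg_left (min_le_right _ _) hq.le).trans_eq (mul_div_cancel₀ _ hq.ne')
  linarith

theorem exp_neg_sum_mul_le_prod {ι : Type*} (F : Finset ι) {q : ι → ℝ}
    (hq : ∀ f ∈ F, 0 < q f) (y : ℝ) :
    Real.exp (-(∑ f ∈ F, q f) * y) ≤
      ∏ f ∈ F, (1 - q f * min 1 ((1 - Real.exp (-(q f) * y)) / q f)) := by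
  rw [← Finset.sum_neg_distrib, Finset.sum_mul, Real.exp_sum]
  exact Finset.prod_le_prod (fun _ _ => (Real.exp_pos _).le)
    fun f hf => exp_neg_mul_le_one_sub_mul_min (hq f hf) y

theorem integral_exp_neg_mul {c : ℝ} (hc : c ≠ 0) (T : ℝ) :
    ∫ y in (0:ℝ)..T, Real.exp (-c * y) = (1 / c) * (1 - Real.exp (-c * T)) := by
  rw [intervalIntegral.integral_comp_mul_left _ (neg_ne_zero.mpr hc), integral_exp,
    mul_zero, Real.exp_zero, smul_eq_mul]
  field_simp
  ring

theorem stmt_2 {ι : Type*} (F : Finset ι) (p : ℝ) (hp : p ∈ Set.Ioo (0:ℝ) 1)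
    (T : ℝ) (hT : T = (1/p) * Real.log (1/(1-p)))
    (pf : ι → ℝ) (hpf : ∀ f ∈ F, pf f ∈ Set.Ioc (0:ℝ) 1)
    (S : ℝ) (hS : S = ∑ f ∈ F, pf f) :
    ∫ y in (0:ℝ)..T,
        (∏ f ∈ F, (1 - pf f * min 1 ((1 - Real.exp (-(pf f) * y)) / pf f)))
          * Real.exp (-p * y)
      ≥ (1/(S + p)) * (1 - (1 - p) ^ ((S + p)/p)) := by
  obtain ⟨hp0, hp1⟩ := hp
  have hS0 : 0 ≤ S := hS ▸ Finset.sum_nonneg fun f hf => (hpf f hf).1.le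
  have hlog : Real.log (1 / (1 - p)) = -Real.log (1 - p) := by
    rw [one_div, Real.log_inv]
  have hT0 : 0 ≤ T := by
    rw [hT, hlog]
    exact mul_nonneg (by positivity)
      (neg_nonneg.mpr (Real.log_nonpos (by linarith) (by linarith)))
  have hpow : (1 - p) ^ ((S + p) / p) = Real.exp (-(S + p) * T) := by
    rw [Real.rpow_def_of_pos (by linarith), hT, hlog]
    congr 1
    ring
  rw [hpow, ← integral_exp_neg_mul (by positivity : S + p ≠ 0)]
  refine intervalIntegral.integral_mono_on hT0 ?_ ?_ fun y _ => ?_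
  · exact Continuous.intervalIntegrable (by fun_prop) _ _
  · exact Continuous.intervalIntegrable (by fun_prop) _ _
  · rw [neg_add, add_mul, Real.exp_add, hS]
    exact mul_le_mul_of_nonneg_right
      (exp_neg_sum_mul_le_prod F (fun f hf => (hpf f hf).1) y) (Real.exp_pos _).le
end

section
/- Define g(p) = (1/(2+p))·(1 − (1−p)^{(2+p)/p}) for p ∈ (0,1). Then g(p) ≥ 1/3 for every p ∈ (0,1). -/
theorem one_sub_rpow_two_div_le {p : ℝ} (hp : p ∈ Set.Ioo (0:ℝ) 1) :
    (1 - p) ^ (2 / p) ≤ 1 / 3 := by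
  obtain ⟨h0, h1⟩ := hp
  calc (1 - p) ^ (2 / p) ≤ (Real.exp (-p)) ^ (2 / p) :=
        Real.rpow_le_rpow (by linarith) (Real.one_sub_le_exp_neg p) (by positivity)
    _ = Real.exp (-2) := by
        rw [← Real.exp_mul]
        congr 1
        field_simp
    _ ≤ 1 / 3 := by
        rw [Real.exp_neg, ← one_div]
        exact one_div_le_one_div_of_le (by norm_num) (by linarith [Real.add_one_le_exp (2 : ℝ)])

theorem stmt_4 (p : ℝ) (hp : p ∈ Set.Ioo (0:ℝ) 1) :
    (1/(2 + p)) * (1 - (1 - p) ^ ((2 + p)/p)) ≥ 1/3 := by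
  have hle := one_sub_rpow_two_div_le hp
  obtain ⟨h0, h1⟩ := hp
  have hexp : (2 + p) / p = 2 / p + 1 := by field_simp
  rw [hexp, Real.rpow_add (by linarith), Real.rpow_one, ge_iff_le, one_div_mul_eq_div,
    div_le_div_iff₀ (by norm_num) (by linarith)]
  nlinarith [mul_le_mul_of_nonneg_right hle (by linarith : (0 : ℝ) ≤ 1 - p)]
end

section
/- Define g(p) = (1/(2+p))·(1 − (1−p)^{(2+p)/p}) for p ∈ (0,1). Then g is decreasing (antitone) on (0,1): for all 0 < p ≤ q < 1, g(q) ≤ g(p). -/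
theorem log_one_sub_le {x : ℝ} (h0 : 0 < x) (h1 : x < 1) :
    Real.log (1 - x) ≤ -(2 * x / (2 - x)) := by
  have hx : 0 < 1 - x := by linarith
  have h := Real.le_log_one_add_of_nonneg (x := x / (1 - x)) (by positivity)
  have e1 : 1 + x / (1 - x) = (1 - x)⁻¹ := by field_simp; ring
  have h2 : 0 < 2 - x := by linarith
  have e2 : 2 * (x / (1 - x)) / (x / (1 - x) + 2) = 2 * x / (2 - x) := by
    have : x / (1 - x) + 2 = (2 - x) / (1 - x) := by field_simp; ring
    rw [this]; field_simp
  rw [e1, e2, Real.log_inv] at h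
  linarith

theorem exp_mul_log_one_sub_le {x : ℝ} (h0 : 0 < x) (h1 : x < 1) :
    Real.exp (Real.log (1 - x) * ((2 + x) / x)) *
      ((2 + x) * ((4 - x) / ((1 - x) * (2 - x))) + 1) ≤ 1 := by
  have hx : 0 < 1 - x := by linarith
  have h2 : 0 < 2 - x := by linarith
  set t := 4 / (2 - x) with ht
  have ht2 : 2 ≤ t := by rw [ht, le_div_iff₀ h2]; linarith
  have hE : Real.exp (Real.log (1 - x) * ((2 + x) / x)) ≤ (1 - x) * Real.exp (-t) := by
    rw [← Real.exp_log hx, ← Real.exp_add, Real.exp_log hx, Real.exp_le_exp]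
    have e : Real.log (1 - x) * ((2 + x) / x)
        = Real.log (1 - x) + Real.log (1 - x) * (2 / x) := by field_simp; ring
    have e' : -(2 * x / (2 - x)) * (2 / x) = -t := by rw [ht]; field_simp; ring
    have := mul_le_mul_of_nonneg_right (log_one_sub_le h0 h1) (by positivity : 0 ≤ 2 / x)
    linarith
  have hw : (1 - x) * ((2 + x) * ((4 - x) / ((1 - x) * (2 - x))) + 1) = 1 + 2 * t := by
    rw [ht]; field_simp; ring
  have hpos : 0 ≤ (2 + x) * ((4 - x) / ((1 - x) * (2 - x))) + 1 := by
    have : 0 < 4 - x := by linarith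
    positivity
  have hexp : 1 + 2 * t ≤ Real.exp t := by
    have := Real.quadratic_le_exp_of_nonneg (x := t) (by linarith)
    nlinarith
  calc _ ≤ (1 - x) * Real.exp (-t) * ((2 + x) * ((4 - x) / ((1 - x) * (2 - x))) + 1) :=
        mul_le_mul_of_nonneg_right hE hpos
    _ = Real.exp (-t) * (1 + 2 * t) := by rw [← hw]; ring
    _ ≤ Real.exp (-t) * Real.exp t := by gcongr
    _ = 1 := by rw [← Real.exp_add]; simp

theorem hasDerivAt_safety {x : ℝ} (h0 : 0 < x) (h1 : x < 1) :
    HasDerivAt (fun y : ℝ ↦ (1 - Real.exp (Real.log (1 - y) * ((2 + y) / y))) / (2 + y))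
      ((-(Real.exp (Real.log (1 - x) * ((2 + x) / x)) *
        (-1 / (1 - x) * ((2 + x) / x) + Real.log (1 - x) * ((1 * x - (2 + x) * 1) / x ^ 2)))
        * (2 + x) - (1 - Real.exp (Real.log (1 - x) * ((2 + x) / x))) * 1) / (2 + x) ^ 2) x := by
  have hx : 1 - x ≠ 0 := by linarith
  have d2 : HasDerivAt (fun y : ℝ ↦ 2 + y) 1 x := (hasDerivAt_id x).const_add 2
  have dl : HasDerivAt (fun y : ℝ ↦ Real.log (1 - y)) (-1 / (1 - x)) x :=
    ((hasDerivAt_id x).const_sub 1).log hx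
  exact (((dl.mul (d2.div (hasDerivAt_id x) h0.ne')).exp).const_sub 1).div d2 (by positivity)

theorem antitoneOn_safety :
    AntitoneOn (fun y : ℝ ↦ (1 - Real.exp (Real.log (1 - y) * ((2 + y) / y))) / (2 + y))
      (Set.Ioo 0 1) := by
  refine antitoneOn_of_deriv_nonpos (convex_Ioo 0 1)
    (fun x hx ↦ (hasDerivAt_safety hx.1 hx.2).continuousAt.continuousWithinAt) ?_ ?_ <;>
    rw [interior_Ioo]
  · exact fun x hx ↦ (hasDerivAt_safety hx.1 hx.2).differentiableAt.differentiableWithinAt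
  · rintro x ⟨h0, h1⟩
    rw [(hasDerivAt_safety h0 h1).deriv]
    refine div_nonpos_of_nonpos_of_nonneg ?_ (by positivity)
    have hE := exp_mul_log_one_sub_le h0 h1
    set E := Real.exp (Real.log (1 - x) * ((2 + x) / x))
    have hE0 : 0 < E := Real.exp_pos _
    have hx : 0 < 1 - x := by linarith
    have h2 : 0 < 2 - x := by linarith
    have hv : -(-1 / (1 - x) * ((2 + x) / x) + Real.log (1 - x) * ((1 * x - (2 + x) * 1) / x ^ 2))
        ≤ (4 - x) / ((1 - x) * (2 - x)) := by
      have := mul_le_mul_of_nonneg_right (log_one_sub_le h0 h1)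
        (by positivity : 0 ≤ 2 / x ^ 2)
      have e : (4 - x) / ((1 - x) * (2 - x))
          = 1 / (1 - x) * ((2 + x) / x) + -(2 * x / (2 - x)) * (2 / x ^ 2) := by
        field_simp; ring
      have e' : (1 * x - (2 + x) * 1) / x ^ 2 = -(2 / x ^ 2) := by ring
      rw [e, e', neg_div]
      linarith
    have := mul_le_mul_of_nonneg_left hv (by positivity : 0 ≤ E * (2 + x))
    linarith

theorem stmt_5 (p q : ℝ) (hp : 0 < p) (hpq : p ≤ q) (hq : q < 1) :
    (1/(2 + q)) * (1 - (1 - q) ^ ((2 + q)/q))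
      ≤ (1/(2 + p)) * (1 - (1 - p) ^ ((2 + p)/p)) := by
  have h := antitoneOn_safety ⟨hp, hpq.trans_lt hq⟩ ⟨hp.trans_le hpq, hq⟩ hpq
  rw [Real.rpow_def_of_pos (by linarith), Real.rpow_def_of_pos (by linarith),
    one_div_mul_eq_div, one_div_mul_eq_div]
  exact h
end

section
/- Define h(p) = (1/(1+p))·(1 − (1−p)^{(1+p)/p}) for p ∈ (0,1). Then h(p) ≥ 1/2 for every p ∈ (0,1). -/
theorem one_sub_rpow_inv_le_half {p : ℝ} (h0 : 0 < p) (h1 : p < 1) :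
    (1 - p) ^ (1 / p) ≤ 1 / 2 := by
  have hq : 0 < 1 - p := by linarith
  have hexp : (1 - p) ^ (1 / p) ≤ Real.exp (-1) := by
    rw [Real.rpow_def_of_pos hq, Real.exp_le_exp, mul_one_div, div_le_iff₀ h0]
    linarith [Real.log_le_sub_one_of_pos hq]
  have he : Real.exp (-1) ≤ 1 / 2 := by
    rw [Real.exp_neg, ← one_div]
    exact one_div_le_one_div_of_le two_pos (by linarith [Real.add_one_le_exp (1 : ℝ)])
  exact hexp.trans he

theorem stmt_7 (p : ℝ) (hp : p ∈ Set.Ioo (0:ℝ) 1) :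
    (1/(1 + p)) * (1 - (1 - p) ^ ((1 + p)/p)) ≥ 1/2 := by
  obtain ⟨h0, h1⟩ := hp
  have hq : 0 < 1 - p := by linarith
  have hsplit : (1 - p) ^ ((1 + p) / p) = (1 - p) ^ (1 / p) * (1 - p) := by
    rw [add_div, div_self h0.ne', Real.rpow_add hq, Real.rpow_one]
  rw [ge_iff_le, hsplit, one_div_mul_eq_div, le_div_iff₀ (by linarith)]
  linarith [mul_le_mul_of_nonneg_right (one_sub_rpow_inv_le_half h0 h1) hq.le]
end

section
/- Define h(p) = (1/(1+p))·(1 − (1−p)^{(1+p)/p}) for p ∈ (0,1). Then h is decreasing (antitone) on (0,1): for all 0 < p ≤ q < 1, h(q) ≤ h(p). -/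
/-- The cubic Taylor lower bound for `-log (1 - x)`. -/
theorem cubic_le_neg_log_one_sub {x : ℝ} (h0 : 0 ≤ x) (h1 : x < 1) :
    x + x ^ 2 / 2 + x ^ 3 / 3 ≤ -Real.log (1 - x) := by
  have hs := Real.hasSum_pow_div_log_of_abs_lt_one (x := x) (by rwa [abs_of_nonneg h0])
  have hle := sum_le_hasSum (Finset.range 3) (fun i _ => by positivity) hs
  norm_num [Finset.sum_range_succ] at hle
  linarith

theorem cubic_le_exp_neg_log_one_sub_div {x : ℝ} (h0 : 0 < x) (h1 : x < 1) :
    5 / 2 + 2 / 3 * x + x ^ 2 / 2 + x ^ 3 / 3 ≤ Real.exp (-Real.log (1 - x) / x) := by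
  have hlog : 1 + x / 2 ≤ -Real.log (1 - x) / x := by
    rw [le_div_iff₀ h0]
    nlinarith [cubic_le_neg_log_one_sub h0.le h1, pow_pos h0 3]
  have hquad := Real.quadratic_le_exp_of_nonneg (x := x / 2) (by positivity)
  have he : (2.7 : ℝ) ≤ Real.exp 1 := by linarith [Real.exp_one_gt_d9]
  calc 5 / 2 + 2 / 3 * x + x ^ 2 / 2 + x ^ 3 / 3
      ≤ 2.7 * (1 + x / 2 + (x / 2) ^ 2 / 2) := by
        have hx2 : x ^ 2 ≤ x := by nlinarith
        have hx3 : x ^ 3 ≤ x := by nlinarith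
        linarith
    _ ≤ Real.exp 1 * Real.exp (x / 2) := by gcongr
    _ = Real.exp (1 + x / 2) := (Real.exp_add _ _).symm
    _ ≤ _ := Real.exp_le_exp.mpr hlog

theorem one_sub_rpow_one_add_div {x : ℝ} (h0 : 0 < x) (h1 : x < 1) :
    (1 - x) ^ ((1 + x) / x) = (1 - x) * Real.exp (Real.log (1 - x) / x) := by
  have hx : 0 < 1 - x := by linarith
  rw [Real.rpow_def_of_pos hx]
  nth_rw 2 [← Real.exp_log hx]
  rw [← Real.exp_add]
  congr 1
  field_simp
  ring

theorem hasDerivAt_one_sub_mul_exp_log_div {x : ℝ} (h0 : 0 < x) (h1 : x < 1) :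
    HasDerivAt (fun y : ℝ => (1 - y) * Real.exp (Real.log (1 - y) / y))
      (-Real.exp (Real.log (1 - x) / x) *
        (1 + 1 / x + (1 - x) * Real.log (1 - x) / x ^ 2)) x := by
  have hx : 1 - x ≠ 0 := by linarith
  have hsub : HasDerivAt (fun y : ℝ => 1 - y) (-1) x := (hasDerivAt_id x).const_sub 1
  refine (hsub.mul (((hsub.log hx).div (hasDerivAt_id x) h0.ne').exp)).congr_deriv ?_
  simp only [id, Pi.div_apply]
  field_simp
  ring

theorem antitoneOn_one_div_one_add_mul_one_sub :
    AntitoneOn (fun x : ℝ =>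
      (1 / (1 + x)) * (1 - (1 - x) * Real.exp (Real.log (1 - x) / x))) (Set.Ioo 0 1) := by
  have hderiv : ∀ x ∈ Set.Ioo (0 : ℝ) 1, HasDerivAt (fun x : ℝ =>
      (1 / (1 + x)) * (1 - (1 - x) * Real.exp (Real.log (1 - x) / x)))
      (((1 + x) * Real.exp (Real.log (1 - x) / x) *
        (1 + 1 / x + (1 - x) * Real.log (1 - x) / x ^ 2) -
        (1 - (1 - x) * Real.exp (Real.log (1 - x) / x))) / (1 + x) ^ 2) x := by
    rintro x ⟨h0, h1⟩
    have hx : 1 + x ≠ 0 := by positivity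
    have hnum := (hasDerivAt_one_sub_mul_exp_log_div h0 h1).const_sub 1
    have hden : HasDerivAt (fun y : ℝ => 1 + y) 1 x := (hasDerivAt_id x).const_add 1
    refine ((hnum.div hden hx).congr_deriv (by ring)).congr_of_eventuallyEq (.of_forall fun y => ?_)
    simp only [Pi.div_apply]
    ring
  refine antitoneOn_of_deriv_nonpos (convex_Ioo 0 1)
    (fun x hx => (hderiv x hx).continuousAt.continuousWithinAt) ?_ ?_
  · rw [interior_Ioo]
    exact fun x hx => (hderiv x hx).differentiableAt.differentiableWithinAt
  rw [interior_Ioo]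
  intro x hx
  rw [(hderiv x hx).deriv]
  obtain ⟨h0, h1⟩ := hx
  refine div_nonpos_of_nonpos_of_nonneg ?_ (sq_nonneg _)
  have hlog : Real.log (1 - x) / x ^ 2 ≤ -(1 / x + 1 / 2 + x / 3) := by
    rw [div_le_iff₀ (by positivity)]
    have h := cubic_le_neg_log_one_sub h0.le h1
    have heq : -(1 / x + 1 / 2 + x / 3) * x ^ 2 = -(x + x ^ 2 / 2 + x ^ 3 / 3) := by
      field_simp
    linarith
  have hfactor : 1 + 1 / x + (1 - x) * Real.log (1 - x) / x ^ 2 ≤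
      3 / 2 + x / 6 + x ^ 2 / 3 := by
    have h := mul_le_mul_of_nonneg_left hlog (sub_nonneg.mpr h1.le)
    have heq : (1 - x) * -(1 / x + 1 / 2 + x / 3) =
        1 / 2 + x / 6 + x ^ 2 / 3 - 1 / x := by
      field_simp
      ring
    rw [mul_div_assoc]
    linarith
  have hmul : (1 + x) * (1 + 1 / x + (1 - x) * Real.log (1 - x) / x ^ 2) + (1 - x) ≤
      Real.exp (-Real.log (1 - x) / x) := by
    have h := mul_le_mul_of_nonneg_left hfactor (by linarith : 0 ≤ 1 + x)
    linarith [cubic_le_exp_neg_log_one_sub_div h0 h1]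
  have hexp := mul_le_mul_of_nonneg_left hmul (Real.exp_pos (Real.log (1 - x) / x)).le
  rw [← Real.exp_add, neg_div, add_neg_cancel, Real.exp_zero] at hexp
  linarith

theorem stmt_8 (p q : ℝ) (hp : 0 < p) (hpq : p ≤ q) (hq : q < 1) :
    (1/(1 + q)) * (1 - (1 - q) ^ ((1 + q)/q))
      ≤ (1/(1 + p)) * (1 - (1 - p) ^ ((1 + p)/p)) := by
  have hq0 : 0 < q := hp.trans_le hpq
  have hp1 : p < 1 := hpq.trans_lt hq
  rw [one_sub_rpow_one_add_div hq0 hq, one_sub_rpow_one_add_div hp hp1]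
  exact antitoneOn_one_div_one_add_mul_one_sub ⟨hp, hp1⟩ ⟨hq0, hq⟩ hpq
end

section
/- Let a, δ, g be real numbers with 0 ≤ a ≤ δ and a ≤ g and 0 < δ. Then for every γ ∈ [0,1], max{ γ·a + (1−γ)·g , γ·δ } ≥ δ·g/(δ + g − a). -/
theorem stmt_10 (a δ g : ℝ) (ha : 0 ≤ a) (haδ : a ≤ δ) (hag : a ≤ g) (hδ : 0 < δ) :
    ∀ γ ∈ Set.Icc (0:ℝ) 1,
      max (γ * a + (1 - γ) * g) (γ * δ) ≥ δ * g / (δ + g - a) := by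
  intro γ _
  have hD : 0 < δ + g - a := by linarith
  rw [ge_iff_le, le_max_iff, div_le_iff₀ hD, div_le_iff₀ hD]
  rcases le_total (γ * (δ + g - a)) g with h | h
  · left
    linarith [mul_nonneg (sub_nonneg.2 hag) (sub_nonneg.2 h)]
  · right
    linarith [mul_le_mul_of_nonneg_left h hδ.le]
end

section
/- Let δ = 0.6022 and g = (1/(2+δ))·(1 − (1−δ)^{(2+δ)/δ}). Then for every γ ∈ [0,1], max{ γ/3 + (1−γ)·g , γ·δ } ≥ 1/2.845. -/
/-- A rational upper bound for the power occurring in `g` at the threshold `0.6022`. -/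
lemma threshold_rpow_le :
    (1 - 0.6022 : ℝ) ^ ((2 + 0.6022 : ℝ) / 0.6022) ≤ 0.01903 := by
  calc (1 - 0.6022 : ℝ) ^ ((2 + 0.6022 : ℝ) / 0.6022)
      ≤ (1 - 0.6022 : ℝ) ^ ((43 : ℕ) * (10 : ℝ)⁻¹) :=
        Real.rpow_le_rpow_of_exponent_ge (by norm_num) (by norm_num) (by norm_num)
    _ = ((1 - 0.6022 : ℝ) ^ 43) ^ (10 : ℝ)⁻¹ := by
        rw [Real.rpow_mul (by norm_num), Real.rpow_natCast]
    _ ≤ 0.01903 := by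
        rw [Real.rpow_inv_le_iff_of_pos (by norm_num) (by norm_num) (by norm_num),
          show (10 : ℝ) = (10 : ℕ) by norm_num, Real.rpow_natCast]
        norm_num

theorem stmt_11 (δ g : ℝ) (hδ : δ = 0.6022)
    (hg : g = (1/(2 + δ)) * (1 - (1 - δ) ^ ((2 + δ)/δ))) :
    ∀ γ ∈ Set.Icc (0:ℝ) 1,
      max (γ/3 + (1 - γ) * g) (γ * δ) ≥ 1/2.845 := by
  rintro γ ⟨-, hγ⟩
  subst hδ
  have hg' : 0.37697 ≤ g := by
    rw [hg]
    linarith [threshold_rpow_le]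
  rw [ge_iff_le, le_max_iff]
  by_contra! h
  have hmul := mul_le_mul_of_nonneg_left hg' (sub_nonneg.2 hγ)
  linarith [h.1, h.2]
end

section
/- Let δ = 0.558 and h = (1/(1+δ))·(1 − (1−δ)^{(1+δ)/δ}). Then for every γ ∈ [0,1], max{ γ/4 + ((1−γ)/2)·h , γ·δ } ≥ 1/3.709. -/
theorem rpow_bound_of_exponent_ge {e : ℝ} (he : 53 / 19 ≤ e) : (0.442 : ℝ) ^ e ≤ 0.1027 := by
  refine (Real.rpow_le_rpow_of_exponent_ge (by norm_num) (by norm_num) he).trans ?_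
  refine le_of_pow_le_pow_left₀ (n := 19) (by norm_num) (by norm_num) ?_
  rw [← Real.rpow_mul_natCast (by norm_num),
    show (53 / 19 : ℝ) * (19 : ℕ) = (53 : ℕ) by norm_num, Real.rpow_natCast]
  norm_num

theorem stmt_12 (δ h : ℝ) (hδ : δ = 0.558)
    (hh : h = (1/(1 + δ)) * (1 - (1 - δ) ^ ((1 + δ)/δ))) :
    ∀ γ ∈ Set.Icc (0:ℝ) 1,
      max (γ/4 + ((1 - γ)/2) * h) (γ * δ) ≥ 1/3.709 := by
  rintro γ ⟨-, hγ⟩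
  have hpow : (1 - δ) ^ ((1 + δ) / δ) ≤ 0.1027 := by
    rw [show 1 - δ = 0.442 by rw [hδ]; norm_num]
    exact rpow_bound_of_exponent_ge (by rw [hδ]; norm_num)
  have hlow : 0.8973 / 1.558 ≤ h := by
    have hδ₁ : 1 + δ = 1.558 := by rw [hδ]; norm_num
    rw [hδ₁] at hh hpow
    linarith
  rw [ge_iff_le, le_max_iff, or_iff_not_imp_right, not_le, hδ]
  intro hlt
  have hprod := mul_le_mul_of_nonneg_left hlow (sub_nonneg.2 hγ)
  norm_num at hlt hprod ⊢
  linarith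
end

section
/- Let F be a finite index set and for each i ∈ F let c_i ∈ [0,1]. Then ∫₀^∞ ( Π_{i∈F} (1 − c_i·(1 − e^{-y})) )·e^{-y} dy ≥ 1/(1 + Σ_{i∈F} c_i). -/
theorem exp_neg_mul_le_one_sub_mul {t : ℝ} (ht : t ∈ Set.Icc (0:ℝ) 1) (y : ℝ) :
    Real.exp (-(t * y)) ≤ 1 - t * (1 - Real.exp (-y)) := by
  have h := convexOn_exp.2 (Set.mem_univ (-y)) (Set.mem_univ 0) ht.1 (sub_nonneg.2 ht.2)
    (by ring)
  simp only [smul_eq_mul, mul_zero, add_zero, Real.exp_zero, mul_neg] at h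
  linarith

theorem exp_neg_sum_mul_le_prod_one_sub_mul {ι : Type*} (F : Finset ι) (c : ι → ℝ)
    (hc : ∀ i ∈ F, c i ∈ Set.Icc (0:ℝ) 1) (y : ℝ) :
    Real.exp (-((∑ i ∈ F, c i) * y)) ≤ ∏ i ∈ F, (1 - c i * (1 - Real.exp (-y))) := by
  rw [Finset.sum_mul, ← Finset.sum_neg_distrib, Real.exp_sum]
  exact Finset.prod_le_prod (fun i _ => (Real.exp_pos _).le)
    fun i hi => exp_neg_mul_le_one_sub_mul (hc i hi) y

theorem prod_one_sub_mul_le_one {ι : Type*} (F : Finset ι) (c : ι → ℝ)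
    (hc : ∀ i ∈ F, c i ∈ Set.Icc (0:ℝ) 1) {y : ℝ} (hy : 0 ≤ y) :
    ∏ i ∈ F, (1 - c i * (1 - Real.exp (-y))) ≤ 1 := by
  have hexp : Real.exp (-y) ≤ 1 := Real.exp_le_one_iff.2 (neg_nonpos.2 hy)
  refine Finset.prod_le_one
    (fun i hi => (Real.exp_pos _).le.trans (exp_neg_mul_le_one_sub_mul (hc i hi) y))
    fun i hi => ?_
  linarith [mul_nonneg (hc i hi).1 (sub_nonneg.2 hexp)]

theorem integrableOn_prod_one_sub_mul_mul_exp_neg {ι : Type*} (F : Finset ι) (c : ι → ℝ)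
    (hc : ∀ i ∈ F, c i ∈ Set.Icc (0:ℝ) 1) :
    MeasureTheory.IntegrableOn
      (fun y => (∏ i ∈ F, (1 - c i * (1 - Real.exp (-y)))) * Real.exp (-y)) (Set.Ioi (0:ℝ)) := by
  have hexp : MeasureTheory.IntegrableOn (fun y : ℝ => Real.exp (-y)) (Set.Ioi 0) := by
    simpa using exp_neg_integrableOn_Ioi 0 one_pos
  refine hexp.mono' (by fun_prop) ?_
  filter_upwards [MeasureTheory.ae_restrict_mem measurableSet_Ioi] with y hy
  have hprod := (Real.exp_pos _).le.trans (exp_neg_sum_mul_le_prod_one_sub_mul F c hc y)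
  rw [Real.norm_of_nonneg (mul_nonneg hprod (Real.exp_pos _).le)]
  exact mul_le_of_le_one_left (Real.exp_pos _).le
    (prod_one_sub_mul_le_one F c hc (le_of_lt hy))

theorem stmt_14 {ι : Type*} (F : Finset ι) (c : ι → ℝ)
    (hc : ∀ i ∈ F, c i ∈ Set.Icc (0:ℝ) 1) :
    ∫ y in Set.Ioi (0:ℝ),
        (∏ i ∈ F, (1 - c i * (1 - Real.exp (-y)))) * Real.exp (-y)
      ≥ 1/(1 + ∑ i ∈ F, c i) := by
  have hsum : 0 ≤ ∑ i ∈ F, c i := Finset.sum_nonneg fun i hi => (hc i hi).1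
  have hneg : -(1 + ∑ i ∈ F, c i) < 0 := by linarith
  have hint : ∫ y in Set.Ioi (0:ℝ), Real.exp (-(1 + ∑ i ∈ F, c i) * y)
      = 1 / (1 + ∑ i ∈ F, c i) := by
    rw [integral_exp_mul_Ioi hneg, mul_zero, Real.exp_zero, neg_div_neg_eq]
  rw [ge_iff_le, ← hint]
  refine MeasureTheory.integral_mono (integrableOn_exp_mul_Ioi hneg 0)
    (integrableOn_prod_one_sub_mul_mul_exp_neg F c hc) fun y => ?_
  calc Real.exp (-(1 + ∑ i ∈ F, c i) * y)
      = Real.exp (-((∑ i ∈ F, c i) * y)) * Real.exp (-y) := by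
        rw [← Real.exp_add]
        ring_nf
    _ ≤ _ := mul_le_mul_of_nonneg_right (exp_neg_sum_mul_le_prod_one_sub_mul F c hc y)
        (Real.exp_pos _).le
end

section
/- Let F be a finite index set and for each i ∈ F let c_i ∈ [0,1], and suppose Σ_{i∈F} c_i ≤ (1 − 1/e)/2. Then ∫₀^∞ ( Π_{i∈F} (1 − c_i·(1 − e^{-y})) )·e^{-y} dy ≥ 2e/(3e − 1). -/
theorem Finset.one_sub_sum_mul_le_prod {ι : Type*} (F : Finset ι) (c : ι → ℝ)
    (hc : ∀ i ∈ F, c i ∈ Set.Icc (0 : ℝ) 1) {u : ℝ} (hu : u ∈ Set.Icc (0 : ℝ) 1) :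
    1 - (∑ i ∈ F, c i) * u ≤ ∏ i ∈ F, (1 - c i * u) := by
  classical
  induction F using Finset.induction_on with
  | empty => simp
  | insert a s ha ih =>
    have hs : ∀ i ∈ s, c i ∈ Set.Icc (0 : ℝ) 1 := fun i hi => hc i (Finset.mem_insert_of_mem hi)
    have hca := hc a (Finset.mem_insert_self a s)
    have hau : 0 ≤ c a * u := mul_nonneg hca.1 hu.1
    have hau' : c a * u ≤ 1 := mul_le_one₀ hca.2 hu.1 hu.2
    have hsu : 0 ≤ (∑ i ∈ s, c i) * u :=
      mul_nonneg (Finset.sum_nonneg fun i hi => (hs i hi).1) hu.1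
    rw [Finset.sum_insert ha, Finset.prod_insert ha]
    calc 1 - (c a + ∑ i ∈ s, c i) * u ≤ (1 - c a * u) * (1 - (∑ i ∈ s, c i) * u) := by
          linarith [mul_nonneg hau hsu]
      _ ≤ _ := mul_le_mul_of_nonneg_left (ih hs) (by linarith)

theorem integrableOn_prod_one_sub_mul_exp_neg {ι : Type*} (F : Finset ι) (c : ι → ℝ)
    (hc : ∀ i ∈ F, c i ∈ Set.Icc (0 : ℝ) 1) :
    MeasureTheory.IntegrableOn
      (fun y => (∏ i ∈ F, (1 - c i * (1 - Real.exp (-y)))) * Real.exp (-y))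
      (Set.Ioi (0 : ℝ)) := by
  refine MeasureTheory.Integrable.mono' (integrableOn_exp_neg_Ioi 0)
    (by fun_prop) ?_
  filter_upwards [MeasureTheory.ae_restrict_mem measurableSet_Ioi] with y hy
  have hy' : Real.exp (-y) ≤ 1 := Real.exp_le_one_iff.2 (by simpa using (Set.mem_Ioi.1 hy).le)
  have hpos := Real.exp_pos (-y)
  have hfac (i : ι) (hi : i ∈ F) : 0 ≤ c i * (1 - Real.exp (-y)) ∧
      c i * (1 - Real.exp (-y)) ≤ 1 :=
    ⟨mul_nonneg (hc i hi).1 (by linarith), mul_le_one₀ (hc i hi).2 (by linarith) (by linarith)⟩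
  have h0 : 0 ≤ ∏ i ∈ F, (1 - c i * (1 - Real.exp (-y))) :=
    Finset.prod_nonneg fun i hi => by linarith [hfac i hi]
  have h1 : ∏ i ∈ F, (1 - c i * (1 - Real.exp (-y))) ≤ 1 :=
    Finset.prod_le_one (fun i hi => by linarith [hfac i hi]) fun i hi => by linarith [hfac i hi]
  rw [Real.norm_of_nonneg (mul_nonneg h0 hpos.le)]
  exact mul_le_of_le_one_left hpos.le h1

theorem integrableOn_exp_neg_two_mul_Ioi :
    MeasureTheory.IntegrableOn (fun y : ℝ => Real.exp (-2 * y)) (Set.Ioi 0) :=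
  integrableOn_exp_mul_Ioi (by norm_num) 0

theorem integral_one_sub_mul_exp_neg (s : ℝ) :
    ∫ y in Set.Ioi (0 : ℝ), ((1 - s) * Real.exp (-y) + s * Real.exp (-2 * y)) = 1 - s / 2 := by
  rw [MeasureTheory.integral_add ((integrableOn_exp_neg_Ioi 0).const_mul _)
      (integrableOn_exp_neg_two_mul_Ioi.const_mul _),
    MeasureTheory.integral_const_mul, MeasureTheory.integral_const_mul, integral_exp_neg_Ioi,
    integral_exp_mul_Ioi (by norm_num)]
  simp
  ring

theorem stmt_15 {ι : Type*} (F : Finset ι) (c : ι → ℝ)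
    (hc : ∀ i ∈ F, c i ∈ Set.Icc (0:ℝ) 1)
    (hsum : ∑ i ∈ F, c i ≤ (1 - 1/Real.exp 1)/2) :
    ∫ y in Set.Ioi (0:ℝ),
        (∏ i ∈ F, (1 - c i * (1 - Real.exp (-y)))) * Real.exp (-y)
      ≥ 2 * Real.exp 1 / (3 * Real.exp 1 - 1) := by
  have hlower : 1 - (∑ i ∈ F, c i) / 2 ≤ ∫ y in Set.Ioi (0:ℝ),
      (∏ i ∈ F, (1 - c i * (1 - Real.exp (-y)))) * Real.exp (-y) := by
    rw [← integral_one_sub_mul_exp_neg]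
    refine MeasureTheory.setIntegral_mono_on
      (((integrableOn_exp_neg_Ioi 0).const_mul _).add
        (integrableOn_exp_neg_two_mul_Ioi.const_mul _))
      (integrableOn_prod_one_sub_mul_exp_neg F c hc) measurableSet_Ioi fun y hy => ?_
    have hy' : Real.exp (-y) ≤ 1 := Real.exp_le_one_iff.2 (by simpa using (Set.mem_Ioi.1 hy).le)
    have hpos := Real.exp_pos (-y)
    have hsq : Real.exp (-2 * y) = Real.exp (-y) * Real.exp (-y) := by
      rw [← Real.exp_add]; ring_nf
    have := mul_le_mul_of_nonneg_right (Finset.one_sub_sum_mul_le_prod F c hc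
      (u := 1 - Real.exp (-y)) ⟨by linarith, by linarith⟩) hpos.le
    rw [hsq]
    linarith
  have he : 1 < Real.exp 1 := Real.one_lt_exp_iff.2 one_pos
  have hnum : 2 * Real.exp 1 / (3 * Real.exp 1 - 1) ≤ 1 - (1 - 1 / Real.exp 1) / 2 / 2 := by
    have hrhs : 1 - (1 - 1 / Real.exp 1) / 2 / 2 = (3 * Real.exp 1 + 1) / (4 * Real.exp 1) := by
      field_simp
      ring
    rw [hrhs, div_le_div_iff₀ (by linarith) (by linarith)]
    nlinarith
  linarith
end

section
/- Let G be a finite simple graph with vertex set V, let δ ∈ (0,1], and let p, x be functions assigning to each edge e of G reals with 0 < p(e) ≤ 1 and 0 ≤ x(e) ≤ 1, such that for every vertex u, Σ_{e incident to u} p(e)·x(e) ≤ 1. Define z(e) = δ·x(e) if p(e) ≥ δ and z(e) = 0 otherwise. Then 0 ≤ z(e) ≤ 1 for every edge e, for every vertex u one has Σ_{e incident to u} z(e) ≤ 1, and for any edge weights w, Σ_e w(e)·p(e)·z(e) = δ·Σ_{e : p(e) ≥ δ} w(e)·p(e)·x(e). -/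
theorem stmt_16 {V : Type*} [Fintype V] [DecidableEq V]
    (G : SimpleGraph V) [DecidableRel G.Adj]
    (δ : ℝ) (hδ : δ ∈ Set.Ioc (0:ℝ) 1)
    (p x w z : Sym2 V → ℝ)
    (hp : ∀ e ∈ G.edgeFinset, 0 < p e ∧ p e ≤ 1)
    (hx : ∀ e ∈ G.edgeFinset, 0 ≤ x e ∧ x e ≤ 1)
    (hdeg : ∀ u : V, ∑ e ∈ G.incidenceFinset u, p e * x e ≤ 1)
    (hz1 : ∀ e, δ ≤ p e → z e = δ * x e)
    (hz2 : ∀ e, p e < δ → z e = 0) :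
    (∀ e ∈ G.edgeFinset, 0 ≤ z e ∧ z e ≤ 1) ∧
    (∀ u : V, ∑ e ∈ G.incidenceFinset u, z e ≤ 1) ∧
    (∑ e ∈ G.edgeFinset, w e * p e * z e
      = δ * ∑ e ∈ G.edgeFinset.filter (fun e => δ ≤ p e), w e * p e * x e) := by
  obtain ⟨hδ0, hδ1⟩ := hδ
  have z_nonneg : ∀ e ∈ G.edgeFinset, 0 ≤ z e := by
    intro e he
    rcases le_or_gt δ (p e) with h | h
    · rw [hz1 e h]
      exact mul_nonneg hδ0.le (hx e he).1
    · rw [hz2 e h]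
  have z_le : ∀ e ∈ G.edgeFinset, z e ≤ p e * x e := by
    intro e he
    rcases le_or_gt δ (p e) with h | h
    · rw [hz1 e h]
      exact mul_le_mul_of_nonneg_right h (hx e he).1
    · rw [hz2 e h]
      exact mul_nonneg (hp e he).1.le (hx e he).1
  refine ⟨fun e he => ⟨z_nonneg e he, ?_⟩, fun u => ?_, ?_⟩
  · exact (z_le e he).trans (mul_le_one₀ (hp e he).2 (hx e he).1 (hx e he).2)
  · refine (Finset.sum_le_sum fun e he => z_le e ?_).trans (hdeg u)
    exact G.incidenceFinset_subset u he
  · rw [Finset.mul_sum, Finset.sum_filter]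
    refine Finset.sum_congr rfl fun e _ => ?_
    split_ifs with h
    · rw [hz1 e h]
      ring
    · rw [hz2 e (not_le.mp h), mul_zero]
end

section
/- There exists δ ∈ (0,1) such that, setting h = (1/(1+δ))·(1 − (1−δ)^{(1+δ)/δ}), for every γ ∈ [0,1]: (1 − 1/e)·max{ (γ/2 + (1−γ)·h)/(1 + h·(1 − 1/e)) , γ·δ } ≥ 1/4.07. (In particular δ = 3/4 works.) -/
theorem quarter_rpow_seven_thirds_le : (1 / 4 : ℝ) ^ (7 / 3 : ℝ) ≤ 0.0393726 := by
  have hpow : ((1 / 4 : ℝ) ^ (7 / 3 : ℝ)) ^ 3 = (1 / 4) ^ 7 := by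
    rw [← Real.rpow_natCast, ← Real.rpow_mul (by norm_num), ← Real.rpow_natCast]
    norm_num
  refine le_of_pow_le_pow_left₀ (n := 3) (by norm_num) (by norm_num) ?_
  rw [hpow]
  norm_num

theorem one_sub_inv_exp_one_ge : (0.63212 : ℝ) ≤ 1 - 1 / Real.exp 1 := by
  have he := Real.exp_one_gt_d9
  have hinv : 1 / Real.exp 1 ≤ 1 / 2.7182818283 :=
    one_div_le_one_div_of_le (by norm_num) he.le
  norm_num at hinv ⊢
  linarith

/-- Either `γ` is large enough for the second branch, or the first branch, which is affine in `γ`,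
is at least its value at the threshold. -/
theorem mul_max_ge_of_bounds {c h γ : ℝ} (hc : 0.63212 ≤ c) (hh : 0.548929 ≤ h) :
    c * max ((γ / 2 + (1 - γ) * h) / (1 + h * c)) (γ * (3 / 4)) ≥ 1 / 4.07 := by
  have hc0 : 0 < c := by linarith
  have hD : 0 < 1 + h * c := by nlinarith
  rcases le_or_gt (1 / 4.07) (c * (γ * (3 / 4))) with hγ | hγ
  · exact hγ.trans (mul_le_mul_of_nonneg_left (le_max_right _ _) hc0.le)
  · refine ge_trans (mul_le_mul_of_nonneg_left (le_max_left _ _) hc0.le) ?_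
    rw [← mul_div_assoc, le_div_iff₀ hD]
    norm_num at hγ hc hh ⊢
    have hslope := mul_le_mul_of_nonneg_right hγ.le (show (0 : ℝ) ≤ h - 1 / 2 by linarith)
    have hprod := mul_nonneg (sub_nonneg.2 hc) (sub_nonneg.2 hh)
    nlinarith

theorem stmt_17 :
    ∃ δ ∈ Set.Ioo (0:ℝ) 1,
      ∀ γ ∈ Set.Icc (0:ℝ) 1,
        (1 - 1/Real.exp 1) *
          max ((γ/2 + (1 - γ) * ((1/(1 + δ)) * (1 - (1 - δ) ^ ((1 + δ)/δ)))) /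
                (1 + ((1/(1 + δ)) * (1 - (1 - δ) ^ ((1 + δ)/δ))) * (1 - 1/Real.exp 1)))
            (γ * δ)
          ≥ 1/4.07 := by
  refine ⟨3 / 4, by norm_num, fun γ _ => ?_⟩
  refine mul_max_ge_of_bounds one_sub_inv_exp_one_ge ?_
  have hy := quarter_rpow_seven_thirds_le
  have hbase : (1 - 3 / 4 : ℝ) = 1 / 4 := by norm_num
  have hexp : ((1 + 3 / 4) / (3 / 4) : ℝ) = 7 / 3 := by norm_num
  rw [hbase, hexp]
  linarith
end
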